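/- Let B₀, ..., B_ℓ: X → ℝ be an interpolation-inspired barrier certificate for a discrete-time stochastic system S with respect to initial set X₀ and unsafe set X_u, i.e., B_i(x) ≥ 0 for all x ∈ X and 0 ≤ i ≤ ℓ; B₀(x) ≤ γ for all x ∈ X₀; B_i(x) ≥ 1 for all x ∈ X_u and 0 ≤ i ≤ ℓ; E[B_{i+1}(f(x,w)) | x] ≤ α_i B_i(x) for all x ∈ X \ X_u and 0 ≤ i < ℓ; and E[B_ℓ(f(x,w)) | x] ≤ B_ℓ(x) for all x ∈ X \ X_u. Then for every x₀ ∈ X₀, P{x_{x₀}(t) ∉ X_u for all t ∈ ℕ} ≥ 1 − γ(1 + ∏_{i=0}^{ℓ−1} α_i + ∑_{t=0}^{ℓ−2} ∏_{i=0}^{t} α_i). -/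

import Mathlib

open MeasureTheory

/-- If `f (Y ω)` pushes the noise `μW` to the conditional law of `Z` given `m'`, then on every
`m'`-measurable event the law of `Z` is that of `f Y w` with `w` drawn independently. -/
theorem map_restrict_eq_map_prod_of_condExp_indicator {Ω X W : Type*} {m' m : MeasurableSpace Ω}
    [MeasurableSpace X] [MeasurableSpace W] {μ : Measure Ω} [IsFiniteMeasure μ]
    {μW : Measure W} [IsFiniteMeasure μW] (hm : m' ≤ m) {Y Z : Ω → X} {f : X → W → X}
    (hY : Measurable Y) (hZ : Measurable Z) (hf : Measurable (Function.uncurry f))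
    (hcond : ∀ s : Set X, MeasurableSet s →
      μ[(fun ω => s.indicator (1 : X → ℝ) (Z ω))|m'] =ᵐ[μ]
        fun ω => ∫ w, s.indicator (1 : X → ℝ) (f (Y ω) w) ∂μW)
    {A : Set Ω} (hA : MeasurableSet[m'] A) :
    (μ.restrict A).map Z = ((μ.restrict A).prod μW).map (fun p => f (Y p.1) p.2) := by
  have hT : Measurable (fun p : Ω × W => f (Y p.1) p.2) :=
    hf.comp ((hY.comp measurable_fst).prodMk measurable_snd)
  have hbound : ∀ (s : Set X) y, ‖s.indicator (1 : X → ℝ) y‖ ≤ 1 := fun s y => by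
    by_cases h : y ∈ s <;> simp [h]
  ext s hs
  have hsm : Measurable (s.indicator (1 : X → ℝ)) := measurable_one.indicator hs
  have hZint : Integrable (fun ω => s.indicator (1 : X → ℝ) (Z ω)) μ :=
    .of_bound (hsm.comp hZ).aestronglyMeasurable 1 (.of_forall fun _ => hbound s _)
  have hTint : Integrable (fun p : Ω × W => s.indicator (1 : X → ℝ) (f (Y p.1) p.2))
      ((μ.restrict A).prod μW) :=
    .of_bound (hsm.comp hT).aestronglyMeasurable 1 (.of_forall fun _ => hbound s _)
  rw [← measureReal_eq_measureReal_iff, ← integral_indicator_one hs, ← integral_indicator_one hs,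
    integral_map hZ.aemeasurable hsm.aestronglyMeasurable,
    integral_map hT.aemeasurable hsm.aestronglyMeasurable, integral_prod _ hTint,
    ← setIntegral_condExp hm hZint hA]
  exact integral_congr_ae (ae_restrict_of_ae (hcond s hs))

/-- A drift bound for `φ ∘ f` integrates to a bound on `φ ∘ Z` over an event of the past. -/
theorem setIntegral_comp_le_of_map_restrict_eq {Ω X W : Type*} {m : MeasurableSpace Ω}
    [MeasurableSpace X] [MeasurableSpace W] {μ : Measure Ω} [SFinite μ]
    {μW : Measure W} [SFinite μW] {Y Z : Ω → X} {f : X → W → X}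
    (hY : Measurable Y) (hZ : Measurable Z) (hf : Measurable (Function.uncurry f))
    {A : Set Ω} (hA : MeasurableSet A)
    (hmap : (μ.restrict A).map Z = ((μ.restrict A).prod μW).map (fun p => f (Y p.1) p.2))
    {φ : X → ℝ} (hφ : Measurable φ) (hint : Integrable (fun ω => φ (Z ω)) μ)
    {ψ : Ω → ℝ} (hψ : Integrable ψ μ) (hle : ∀ ω ∈ A, ∫ w, φ (f (Y ω) w) ∂μW ≤ ψ ω) :
    ∫ ω in A, φ (Z ω) ∂μ ≤ ∫ ω in A, ψ ω ∂μ := by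
  have hT : Measurable (fun p : Ω × W => f (Y p.1) p.2) :=
    hf.comp ((hY.comp measurable_fst).prodMk measurable_snd)
  have hTint : Integrable (fun p : Ω × W => φ (f (Y p.1) p.2)) ((μ.restrict A).prod μW) := by
    refine (integrable_map_measure hφ.aestronglyMeasurable hT.aemeasurable).1 ?_
    rw [← hmap]
    exact (integrable_map_measure hφ.aestronglyMeasurable hZ.aemeasurable).2 hint.restrict
  rw [← integral_map hZ.aemeasurable hφ.aestronglyMeasurable, hmap,
    integral_map hT.aemeasurable hφ.aestronglyMeasurable, integral_prod _ hTint]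
  exact setIntegral_mono_on hTint.integral_prod_left hψ.restrict hA hle

/-- The event that `x` avoids `U` strictly before time `t`. -/
def avoidsBefore {Ω X : Type*} (x : ℕ → Ω → X) (U : Set X) (t : ℕ) : Set Ω :=
  {ω | ∀ s < t, x s ω ∉ U}

section avoidsBefore

variable {Ω X : Type*} {x : ℕ → Ω → X} {U : Set X}

theorem avoidsBefore_zero : avoidsBefore x U 0 = Set.univ := by
  simp [avoidsBefore]

theorem avoidsBefore_succ (t : ℕ) :
    avoidsBefore x U (t + 1) = avoidsBefore x U t \ x t ⁻¹' U := by
  ext ω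
  simp only [avoidsBefore, Nat.lt_succ_iff_lt_or_eq, or_imp, forall_and, forall_eq, Set.mem_ofPred_eq,
    Set.mem_sdiff, Set.mem_preimage]

theorem antitone_avoidsBefore : Antitone (avoidsBefore x U) :=
  fun _ _ hst _ h s hs => h s (hs.trans_le hst)

theorem iInter_avoidsBefore : ⋂ t, avoidsBefore x U t = {ω | ∀ t, x t ω ∉ U} := by
  ext ω
  simp only [avoidsBefore, Set.mem_iInter, Set.mem_ofPred_eq]
  exact ⟨fun h t => h (t + 1) t t.lt_succ_self, fun h _ s _ => h s⟩

theorem measurableSet_avoidsBefore [MeasurableSpace X] {m : MeasurableSpace Ω}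
    (hU : MeasurableSet U) {t : ℕ} (hx : ∀ s < t, Measurable (x s)) :
    MeasurableSet (avoidsBefore x U t) := by
  induction t with
  | zero => simp [avoidsBefore_zero]
  | succ t ih =>
    rw [avoidsBefore_succ]
    exact (ih fun s hs => hx s (hs.trans t.lt_succ_self)).diff (hx t t.lt_succ_self hU)

/-- A function that is at least `1` on `U` loses at least the probability of a first visit to `U`
at time `t` when its integral is restricted to the paths that also avoid `U` at time `t`. -/
theorem setIntegral_avoidsBefore_succ_le [MeasurableSpace X] {m : MeasurableSpace Ω}
    {μ : Measure Ω} [IsFiniteMeasure μ] (hU : MeasurableSet U) (hx : ∀ t, Measurable (x t))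
    {t : ℕ} {ψ : Ω → ℝ} (hψ : Integrable ψ μ) (hψU : ∀ ω, x t ω ∈ U → 1 ≤ ψ ω) :
    ∫ ω in avoidsBefore x U (t + 1), ψ ω ∂μ ≤ ∫ ω in avoidsBefore x U t, ψ ω ∂μ -
      (μ.real (avoidsBefore x U t) - μ.real (avoidsBefore x U (t + 1))) := by
  have hm : MeasurableSet (avoidsBefore x U t) :=
    measurableSet_avoidsBefore hU fun s _ => hx s
  have hpre : MeasurableSet (x t ⁻¹' U) := hx t hU
  have hsplit := integral_inter_add_sdiff hpre (hψ.integrableOn (s := avoidsBefore x U t))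
  have hmeas := measureReal_inter_add_sdiff (μ := μ) (s := avoidsBefore x U t) hpre
  have hlow : μ.real (avoidsBefore x U t ∩ x t ⁻¹' U) ≤
      ∫ ω in avoidsBefore x U t ∩ x t ⁻¹' U, ψ ω ∂μ := by
    have := setIntegral_mono_on (μ := μ) (integrable_const (1 : ℝ)).integrableOn hψ.integrableOn
      (hm.inter hpre) fun ω hω => hψU ω hω.2
    simpa using this
  rw [avoidsBefore_succ]
  linarith

end avoidsBefore

/-- Theorem 3.2: interpolation-inspired barrier certificates imply safety with probability at
least `1 - γ (1 + ∏_{i<ℓ} α_i + ∑_{t=0}^{ℓ-2} ∏_{i=0}^{t} α_i)`. -/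
theorem stmt_4 {Ω : Type*} {m : MeasurableSpace Ω} (μ : Measure Ω) [IsProbabilityMeasure μ]
    {X : Type*} [MeasurableSpace X] {W : Type*} [MeasurableSpace W]
    (μW : Measure W) [IsProbabilityMeasure μW]
    (Xs X0 Xu : Set X) (hX0sub : X0 ⊆ Xs) (hXusub : Xu ⊆ Xs) (hXu : MeasurableSet Xu)
    (f : X → W → X) (hf : Measurable (Function.uncurry f))
    (ℓ : ℕ) (B : ℕ → X → ℝ) (hBmeas : ∀ i, Measurable (B i))
    (α : ℕ → ℝ) (hα : ∀ i < ℓ, 0 < α i)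
    (γ : ℝ) (hγ0 : 0 ≤ γ) (hγ1 : γ ≤ 1)
    -- IBC conditions (Definition 3.1)
    (hB0 : ∀ i ≤ ℓ, ∀ x ∈ Xs, 0 ≤ B i x)
    (hBinit : ∀ x ∈ X0, B 0 x ≤ γ)
    (hBunsafe : ∀ i ≤ ℓ, ∀ x ∈ Xu, 1 ≤ B i x)
    (hBstep : ∀ i < ℓ, ∀ x ∈ Xs \ Xu, ∫ w, B (i + 1) (f x w) ∂μW ≤ α i * B i x)
    (hBsuper : ∀ x ∈ Xs \ Xu, ∫ w, B ℓ (f x w) ∂μW ≤ B ℓ x)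
    -- the solution process starting from x0 ∈ X0
    (x0 : X) (hx0 : x0 ∈ X0)
    (x : ℕ → Ω → X) (ℱ : Filtration ℕ m)
    (hadapted : ∀ t, Measurable[ℱ t] (x t))
    (hmeasx : ∀ t, Measurable (x t))
    (hinit : ∀ ω, x 0 ω = x0)
    (hinv : ∀ t ω, x t ω ∈ Xs)
    (hintB : ∀ i t, Integrable (fun ω => B i (x t ω)) μ)
    (hMarkov : ∀ (t : ℕ) (g : X → ℝ), Measurable g → (∃ C, ∀ y, |g y| ≤ C) →
      μ[(fun ω => g (x (t + 1) ω))|ℱ t] =ᵐ[μ]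
        fun ω => ∫ w, g (f (x t ω) w) ∂μW) :
    ENNReal.ofReal (1 - γ * (1 + ∏ i ∈ Finset.range ℓ, α i +
        ∑ t ∈ Finset.range (ℓ - 1), ∏ i ∈ Finset.range (t + 1), α i)) ≤
      μ {ω | ∀ t, x t ω ∉ Xu} := by
  have hmU : ∀ t, MeasurableSet (avoidsBefore x Xu t) := fun t =>
    measurableSet_avoidsBefore hXu fun s _ => hmeasx s
  have hdrift : ∀ (i j t : ℕ) (c : ℝ), 0 ≤ c → i ≤ ℓ →
      (∀ y ∈ Xs \ Xu, ∫ w, B j (f y w) ∂μW ≤ c * B i y) →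
      ∫ ω in avoidsBefore x Xu (t + 1), B j (x (t + 1) ω) ∂μ ≤
        c * (∫ ω in avoidsBefore x Xu t, B i (x t ω) ∂μ -
          (μ.real (avoidsBefore x Xu t) - μ.real (avoidsBefore x Xu (t + 1)))) := by
    intro i j t c hc hi hij
    have hmap := map_restrict_eq_map_prod_of_condExp_indicator (μ := μ) (μW := μW) (ℱ.le t)
      (hmeasx t) (hmeasx (t + 1)) hf
      (fun s hs => hMarkov t _ (measurable_one.indicator hs)
        ⟨1, fun y => by by_cases h : y ∈ s <;> simp [h]⟩)
      (measurableSet_avoidsBefore (m := ℱ t) hXu fun s hs =>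
        (hadapted s).mono (ℱ.mono (Nat.lt_succ_iff.1 hs)) le_rfl)
    refine (setIntegral_comp_le_of_map_restrict_eq (hmeasx t) (hmeasx (t + 1)) hf (hmU (t + 1))
      hmap (hBmeas j) (hintB j (t + 1)) ((hintB i t).const_mul c)
      fun ω hω => hij _ ⟨hinv t ω, hω t t.lt_succ_self⟩).trans ?_
    rw [integral_const_mul]
    exact mul_le_mul_of_nonneg_left (setIntegral_avoidsBefore_succ_le hXu hmeasx (hintB i t)
      fun ω hω => hBunsafe i hi _ hω) hc
  have hnonneg : ∀ i ≤ ℓ, ∀ s t, 0 ≤ ∫ ω in avoidsBefore x Xu s, B i (x t ω) ∂μ :=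
    fun i hi s t => integral_nonneg fun ω => hB0 i hi _ (hinv t ω)
  have hanti : ∀ t, μ.real (avoidsBefore x Xu (t + 1)) ≤ μ.real (avoidsBefore x Xu t) :=
    fun t => measureReal_mono (antitone_avoidsBefore t.le_succ)
  have hfirst : ∀ t ≤ ℓ,
      ∫ ω in avoidsBefore x Xu t, B t (x t ω) ∂μ ≤ γ * ∏ i ∈ Finset.range t, α i := by
    intro t
    induction t with
    | zero => simpa [avoidsBefore_zero, hinit] using hBinit x0 hx0
    | succ t ih =>
      intro ht
      have hαt := (hα t ht).le
      calc _ ≤ _ := hdrift t (t + 1) t (α t) hαt (by omega) (hBstep t ht)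
        _ ≤ α t * (γ * ∏ i ∈ Finset.range t, α i) :=
          mul_le_mul_of_nonneg_left (by linarith [hanti t, ih (by omega)]) hαt
        _ = _ := by rw [Finset.prod_range_succ]; ring
  have hbefore : ∀ t ≤ ℓ, 1 - γ * ∑ s ∈ Finset.range t, ∏ i ∈ Finset.range s, α i ≤
      μ.real (avoidsBefore x Xu t) := by
    intro t
    induction t with
    | zero => simp [avoidsBefore_zero]
    | succ t ih =>
      intro ht
      have hloss := setIntegral_avoidsBefore_succ_le (t := t) hXu hmeasx (hintB t t)
        fun ω hω => hBunsafe t (by omega) _ hω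
      rw [Finset.sum_range_succ, mul_add]
      linarith [hnonneg t (by omega) (t + 1) t, hfirst t (by omega), ih (by omega)]
  have hafter : ∀ k, μ.real (avoidsBefore x Xu ℓ) - ∫ ω in avoidsBefore x Xu ℓ, B ℓ (x ℓ ω) ∂μ ≤
      μ.real (avoidsBefore x Xu (ℓ + k)) -
        ∫ ω in avoidsBefore x Xu (ℓ + k), B ℓ (x (ℓ + k) ω) ∂μ := by
    intro k
    induction k with
    | zero => simp
    | succ k ih =>
      have hstep := hdrift ℓ ℓ (ℓ + k) 1 zero_le_one le_rfl (by simpa using hBsuper)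
      rw [← add_assoc]
      linarith
  have hsum : ∑ s ∈ Finset.range ℓ, ∏ i ∈ Finset.range s, α i ≤
      1 + ∑ t ∈ Finset.range (ℓ - 1), ∏ i ∈ Finset.range (t + 1), α i := by
    cases ℓ with
    | zero => simp
    | succ n => simp [Finset.sum_range_succ', add_comm]
  have hlower : ∀ t, ENNReal.ofReal (1 - γ * (1 + ∏ i ∈ Finset.range ℓ, α i +
      ∑ t ∈ Finset.range (ℓ - 1), ∏ i ∈ Finset.range (t + 1), α i)) ≤
        μ (avoidsBefore x Xu t) := by
    intro t
    refine le_trans ?_ (measure_mono (antitone_avoidsBefore (Nat.le_add_left t ℓ)))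
    rw [ENNReal.ofReal_le_iff_le_toReal (measure_ne_top _ _)]
    change _ ≤ μ.real _
    linarith [hafter t, hbefore ℓ le_rfl, hfirst ℓ le_rfl, hnonneg ℓ le_rfl (ℓ + t) (ℓ + t),
      mul_le_mul_of_nonneg_left hsum hγ0]
  rw [← iInter_avoidsBefore]
  exact ge_of_tendsto' (tendsto_measure_iInter_atTop (fun t => (hmU t).nullMeasurableSet)
    antitone_avoidsBefore ⟨0, measure_ne_top _ _⟩) hlower
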